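/- There exist complex numbers z_k ∈ ℂ with z_k → ∞, and complex numbers a_k with a_k · conj(z_k) > 0 (real and positive) and ∑ |a_k/z_k| < ∞, such that f(z) = ∑_{k=1}^∞ a_k/(z - z_k) has no zeros in ℂ. -/

import Mathlib

open Complex Filter Real

/-- The prescribed moduli of the poles. -/
noncomputable def modulus (j : ℕ) : ℝ := 64 ^ (j ^ 2)

/-- The argument of the `j`-th pole, in terms of a rescaled (bounded) sequence. -/
noncomputable def phase (t : ℕ → ℝ) (j : ℕ) : ℝ := (j + 1) * t j

/-- The `j`-th pole. -/
noncomputable def node (t : ℕ → ℝ) (j : ℕ) : ℂ :=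
  modulus j * Complex.exp (phase t j * Complex.I)

noncomputable def ratioLog (t : ℕ → ℝ) (i j : ℕ) : ℂ :=
  Complex.log (1 - node t i / node t j)

/-- The logarithm of `1 - x`, where `x` is the quotient of the smaller by the larger of the
poles `i` and `j`. -/
noncomputable def interaction (t : ℕ → ℝ) (j i : ℕ) : ℂ :=
  if i < j then ratioLog t i j else if j < i then ratioLog t j i else 0

lemma modulus_pos (j : ℕ) : 0 < modulus j := by
  unfold modulus; positivity

lemma modulus_ratio_le {i j : ℕ} (h : i < j) : modulus i / modulus j ≤ (1 / 64) ^ (i + j) := by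
  rw [div_le_iff₀ (modulus_pos j), one_div, inv_pow, ← div_eq_inv_mul, le_div_iff₀ (by positivity)]
  unfold modulus
  rw [← pow_add]
  exact pow_le_pow_right₀ (by norm_num) (by nlinarith)

lemma two_pow_le_modulus (j : ℕ) : 2 ^ j ≤ modulus j := by
  unfold modulus
  calc (2 : ℝ) ^ j ≤ 64 ^ j := by gcongr; norm_num
    _ ≤ 64 ^ (j ^ 2) := pow_le_pow_right₀ (by norm_num) (by nlinarith [Nat.le_self_pow two_ne_zero j])

lemma node_ne_zero (t : ℕ → ℝ) (j : ℕ) : node t j ≠ 0 :=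
  mul_ne_zero (by exact_mod_cast (modulus_pos j).ne') (Complex.exp_ne_zero _)

lemma norm_node (t : ℕ → ℝ) (j : ℕ) : ‖node t j‖ = modulus j := by
  rw [node, norm_mul, Complex.norm_exp_ofReal_mul_I, mul_one, Complex.norm_real,
    Real.norm_of_nonneg (modulus_pos j).le]

lemma node_div (t : ℕ → ℝ) (i j : ℕ) : node t i / node t j =
    (modulus i / modulus j : ℝ) * Complex.exp ((phase t i - phase t j : ℝ) * Complex.I) := by
  unfold node
  push_cast
  rw [mul_div_mul_comm, ← Complex.exp_sub]
  ring_nf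

lemma norm_node_div_le (t : ℕ → ℝ) {i j : ℕ} (h : i < j) :
    ‖node t i / node t j‖ ≤ (1 / 64) ^ (i + j) := by
  rw [norm_div, norm_node, norm_node]
  exact modulus_ratio_le h

lemma norm_node_div_le_half (t : ℕ → ℝ) {i j : ℕ} (h : i < j) :
    ‖node t i / node t j‖ ≤ 1 / 2 := by
  refine (norm_node_div_le t h).trans ?_
  calc (1 / 64 : ℝ) ^ (i + j) ≤ (1 / 64) ^ 1 :=
        pow_le_pow_of_le_one (by norm_num) (by norm_num) (by omega)
    _ ≤ 1 / 2 := by norm_num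

lemma norm_exp_mul_I_sub_le (a b : ℝ) :
    ‖Complex.exp (a * Complex.I) - Complex.exp (b * Complex.I)‖ ≤ |a - b| := by
  have h : Complex.exp (a * Complex.I) - Complex.exp (b * Complex.I) =
      Complex.exp (b * Complex.I) * (Complex.exp (Complex.I * (a - b : ℝ)) - 1) := by
    rw [mul_sub, ← Complex.exp_add, mul_one]
    push_cast
    ring_nf
  rw [h, norm_mul, Complex.norm_exp_ofReal_mul_I, one_mul]
  exact Real.norm_exp_I_mul_ofReal_sub_one_le

lemma norm_log_one_sub_sub_le {x y : ℂ} (hx : ‖x‖ ≤ 1 / 2) (hy : ‖y‖ ≤ 1 / 2) :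
    ‖Complex.log (1 - x) - Complex.log (1 - y)‖ ≤ 2 * ‖x - y‖ := by
  refine Convex.norm_image_sub_le_of_norm_hasDerivWithin_le (s := Metric.closedBall (0 : ℂ) (1 / 2))
    (f := fun z => Complex.log (1 - z)) (f' := fun z => -1 / (1 - z)) ?_ ?_
    (convex_closedBall _ _) (by simpa using hy) (by simpa using hx)
  · intro z hz
    have hz' : ‖z‖ < 1 := by
      have : ‖z‖ ≤ 1 / 2 := by simpa using hz
      linarith
    refine (((hasDerivAt_id z).const_sub 1).clog ?_).hasDerivWithinAt
    have := Complex.mem_slitPlane_of_norm_lt_one (z := -z) (by simpa using hz')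
    simpa [sub_eq_add_neg] using this
  · intro z hz
    have hz' : ‖z‖ ≤ 1 / 2 := by simpa using hz
    have h1 : 1 / 2 ≤ ‖1 - z‖ := by
      have := norm_sub_norm_le (1 : ℂ) z
      rw [norm_one] at this
      linarith
    rw [norm_div, norm_neg, norm_one, div_le_iff₀ (by linarith)]
    linarith

lemma norm_ratioLog_le (t : ℕ → ℝ) {i j : ℕ} (h : i < j) :
    ‖ratioLog t i j‖ ≤ 2 * (1 / 64) ^ (i + j) := by
  have := norm_log_one_sub_sub_le (norm_node_div_le_half t h) (y := 0) (by norm_num)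
  simp only [sub_zero, Complex.log_one] at this
  exact this.trans (by gcongr; exact norm_node_div_le t h)

lemma norm_ratioLog_sub_le {s t : ℕ → ℝ} {δ : ℝ} (hδ : ∀ i, |t i - s i| ≤ δ) {i j : ℕ}
    (h : i < j) : ‖ratioLog t i j - ratioLog s i j‖ ≤ 4 * (1 / 32) ^ (i + j) * δ := by
  have hδ0 : 0 ≤ δ := (abs_nonneg _).trans (hδ 0)
  have hphase (k : ℕ) : |phase t k - phase s k| ≤ (k + 1) * δ := by
    rw [phase, phase, ← mul_sub, abs_mul, abs_of_nonneg (by positivity)]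
    gcongr
    exact hδ k
  have hpow : ((i : ℝ) + j + 2) ≤ 2 * 2 ^ (i + j) := by
    have : i + j + 1 ≤ 2 ^ (i + j) := Nat.lt_two_pow_self
    have : ((i : ℝ) + j + 1) ≤ 2 ^ (i + j) := by exact_mod_cast this
    have h1 : (0 : ℝ) ≤ i + j := by positivity
    linarith
  calc _ ≤ 2 * ‖node t i / node t j - node s i / node s j‖ :=
        norm_log_one_sub_sub_le (norm_node_div_le_half t h) (norm_node_div_le_half s h)
    _ ≤ 2 * ((1 / 64) ^ (i + j) * ((i + j + 2) * δ)) := by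
        rw [node_div, node_div, ← mul_sub, norm_mul, Complex.norm_real,
          Real.norm_of_nonneg (div_pos (modulus_pos i) (modulus_pos j)).le]
        gcongr
        · exact modulus_ratio_le h
        · refine (norm_exp_mul_I_sub_le _ _).trans ?_
          have := abs_sub (phase t i - phase s i) (phase t j - phase s j)
          have h1 := hphase i
          have h2 := hphase j
          rw [show phase t i - phase t j - (phase s i - phase s j) =
            (phase t i - phase s i) - (phase t j - phase s j) by ring]
          linarith
    _ ≤ 2 * ((1 / 64) ^ (i + j) * (2 * 2 ^ (i + j) * δ)) := by gcongr
    _ = 4 * (1 / 32) ^ (i + j) * δ := by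
        rw [show (1 / 32 : ℝ) = 1 / 64 * 2 by norm_num, mul_pow]
        ring

lemma norm_interaction_le (t : ℕ → ℝ) (j i : ℕ) :
    ‖interaction t j i‖ ≤ 2 * (1 / 64) ^ j * (1 / 64) ^ i := by
  rw [mul_assoc, ← pow_add]
  unfold interaction
  split_ifs with h h'
  · rw [add_comm j]; exact norm_ratioLog_le t h
  · exact norm_ratioLog_le t h'
  · rw [norm_zero]; positivity

lemma norm_interaction_sub_le {s t : ℕ → ℝ} {δ : ℝ} (hδ : ∀ i, |t i - s i| ≤ δ) (j i : ℕ) :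
    ‖interaction t j i - interaction s j i‖ ≤ 4 * (1 / 32) ^ j * δ * (1 / 32) ^ i := by
  have hδ0 : 0 ≤ δ := (abs_nonneg _).trans (hδ 0)
  rw [show 4 * (1 / 32 : ℝ) ^ j * δ * (1 / 32) ^ i = 4 * (1 / 32) ^ (j + i) * δ by ring]
  unfold interaction
  split_ifs with h h'
  · rw [add_comm j]; exact norm_ratioLog_sub_le hδ h
  · exact norm_ratioLog_sub_le hδ h'
  · rw [sub_zero, norm_zero]; positivity

lemma hasSum_geometric_bound (c : ℝ) {r : ℝ} (h0 : 0 ≤ r) (h1 : r < 1) :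
    HasSum (fun i => c * r ^ i) (c * (1 - r)⁻¹) :=
  (hasSum_geometric_of_lt_one h0 h1).mul_left c

lemma summable_interaction (t : ℕ → ℝ) (j : ℕ) : Summable (interaction t j) :=
  (hasSum_geometric_bound _ (by norm_num) (by norm_num)).summable.of_norm_bounded
    (norm_interaction_le t j)

lemma norm_tsum_interaction_le (t : ℕ → ℝ) (j : ℕ) : ‖∑' i, interaction t j i‖ ≤ 3 := by
  refine (tsum_of_norm_bounded (hasSum_geometric_bound _ (by norm_num) (by norm_num))
    (norm_interaction_le t j)).trans ?_
  have : (1 / 64 : ℝ) ^ j ≤ 1 := pow_le_one₀ (by norm_num) (by norm_num)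
  norm_num at this ⊢
  linarith

lemma norm_tsum_interaction_sub_le {s t : ℕ → ℝ} {δ : ℝ} (hδ : ∀ i, |t i - s i| ≤ δ) {j : ℕ}
    (hj : j ≠ 0) :
    ‖(∑' i, interaction t j i) - ∑' i, interaction s j i‖ ≤ δ / 4 := by
  have hδ0 : 0 ≤ δ := (abs_nonneg _).trans (hδ 0)
  rw [← (summable_interaction t j).tsum_sub (summable_interaction s j)]
  refine (tsum_of_norm_bounded (hasSum_geometric_bound _ (by norm_num) (by norm_num))
    (norm_interaction_sub_le hδ j)).trans ?_
  have h : (1 / 32 : ℝ) ^ j ≤ (1 / 32) ^ 1 :=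
    pow_le_pow_of_le_one (by norm_num) (by norm_num) (by omega)
  have := mul_le_mul_of_nonneg_right h hδ0
  norm_num at this ⊢
  linarith

/-- The map whose fixed points are the phases making all residues positive multiples of
the poles. -/
noncomputable def phaseMap (t : ℕ → ℝ) (j : ℕ) : ℝ :=
  (∑ i ∈ Finset.range j, phase t i - j * Real.pi - (∑' i, interaction t j i).im) / (j * (j + 1))

lemma sum_range_cast_add_one (j : ℕ) :
    ∑ i ∈ Finset.range j, ((i : ℝ) + 1) = j * (j + 1) / 2 := by
  induction j with
  | zero => simp
  | succ n ih => rw [Finset.sum_range_succ, ih]; push_cast; ring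

lemma abs_phaseMap_sub_le {s t : ℕ → ℝ} {δ : ℝ} (hδ : ∀ i, |t i - s i| ≤ δ) (j : ℕ) :
    |phaseMap t j - phaseMap s j| ≤ 3 / 4 * δ := by
  have hδ0 : 0 ≤ δ := (abs_nonneg _).trans (hδ 0)
  rcases eq_or_ne j 0 with rfl | hj
  · simp only [phaseMap, Nat.cast_zero, zero_mul, div_zero, sub_self, abs_zero]
    positivity
  have hj1 : (1 : ℝ) ≤ j := by exact_mod_cast Nat.one_le_iff_ne_zero.mpr hj
  have hA : |∑ i ∈ Finset.range j, phase t i - ∑ i ∈ Finset.range j, phase s i| ≤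
      j * (j + 1) / 2 * δ := by
    rw [← Finset.sum_sub_distrib, ← sum_range_cast_add_one, Finset.sum_mul]
    refine (Finset.abs_sum_le_sum_abs _ _).trans (Finset.sum_le_sum fun i _ => ?_)
    rw [phase, phase, ← mul_sub, abs_mul, abs_of_nonneg (by positivity)]
    gcongr
    exact hδ i
  have hB := (Complex.abs_im_le_norm _).trans (norm_tsum_interaction_sub_le hδ hj)
  rw [Complex.sub_im] at hB
  rw [phaseMap, phaseMap, ← sub_div, abs_div, abs_of_pos (by positivity : (0 : ℝ) < j * (j + 1)),
    div_le_iff₀ (by positivity)]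
  have h1 : δ * 2 ≤ δ * (j * (j + 1)) := by gcongr; nlinarith
  rw [abs_le] at hA hB ⊢
  constructor <;> linarith

lemma abs_phaseMap_le {t : ℕ → ℝ} {M : ℝ} (hM : ∀ i, |t i| ≤ M) (j : ℕ) :
    |phaseMap t j| ≤ 3 / 4 * M + |phaseMap 0 j| := by
  have := abs_phaseMap_sub_le (t := t) (s := 0) (δ := M) (by simpa using hM) j
  have h2 := abs_sub_abs_le_abs_sub (phaseMap t j) (phaseMap 0 j)
  linarith

lemma abs_phaseMap_zero_le (j : ℕ) : |phaseMap 0 j| ≤ Real.pi + 3 := by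
  rcases eq_or_ne j 0 with rfl | hj
  · simp only [phaseMap, Nat.cast_zero, zero_mul, div_zero, abs_zero]
    positivity
  have hj1 : (1 : ℝ) ≤ j := by exact_mod_cast Nat.one_le_iff_ne_zero.mpr hj
  have hB := (Complex.abs_im_le_norm _).trans (norm_tsum_interaction_le 0 j)
  rw [phaseMap, abs_div, abs_of_pos (by positivity : (0 : ℝ) < j * (j + 1)),
    div_le_iff₀ (by positivity)]
  have h0 : ∑ i ∈ Finset.range j, phase 0 i = 0 := Finset.sum_eq_zero fun i _ => by simp [phase]
  rw [h0]
  have := Real.pi_pos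
  have h1 : Real.pi * 1 ≤ Real.pi * (j * j) := by gcongr; nlinarith
  rw [abs_le] at hB ⊢
  constructor <;> nlinarith

lemma exists_phaseMap_fixedPoint : ∃ t : ℕ → ℝ, phaseMap t = t := by
  have hbd (t : BoundedContinuousFunction ℕ ℝ) (j : ℕ) :
      ‖phaseMap t j‖ ≤ 3 / 4 * ‖t‖ + (Real.pi + 3) :=
    (abs_phaseMap_le (fun i => t.norm_coe_le_norm i) j).trans
      (by gcongr; exact abs_phaseMap_zero_le j)
  let T : BoundedContinuousFunction ℕ ℝ → BoundedContinuousFunction ℕ ℝ := fun t =>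
    BoundedContinuousFunction.ofNormedAddCommGroupDiscrete (phaseMap t) _ (hbd t)
  have hT : ContractingWith (3 / 4) T := by
    refine ⟨by rw [← NNReal.coe_lt_coe]; norm_num, LipschitzWith.of_dist_le_mul fun t s => ?_⟩
    refine (BoundedContinuousFunction.dist_le (by positivity)).mpr fun j => ?_
    have := abs_phaseMap_sub_le (t := t) (s := s) (δ := dist t s)
      (fun i => (Real.dist_eq _ _).symm.trans_le
        (BoundedContinuousFunction.dist_coe_le_dist (f := t) (g := s) i)) j
    simpa [T, Real.dist_eq] using this
  obtain ⟨p, hp⟩ : ∃ p, T p = p := ⟨_, hT.fixedPoint_isFixedPt⟩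
  exact ⟨p, congrArg (fun f : BoundedContinuousFunction ℕ ℝ => (f : ℕ → ℝ)) hp⟩

/-- The main part of `logFactor`, present only for poles of smaller modulus. -/
noncomputable def leadingLog (t : ℕ → ℝ) (j i : ℕ) : ℂ :=
  if i < j then (Real.log (modulus j / modulus i) : ℝ) +
    (phase t j - phase t i + Real.pi : ℝ) * Complex.I else 0

/-- A logarithm of `1 - node t j / node t i`; it vanishes for `i = j`. -/
noncomputable def logFactor (t : ℕ → ℝ) (j i : ℕ) : ℂ := interaction t j i + leadingLog t j i

lemma exp_ratioLog (t : ℕ → ℝ) {i j : ℕ} (h : i < j) :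
    Complex.exp (ratioLog t i j) = 1 - node t i / node t j := by
  refine Complex.exp_log fun h0 => ?_
  have h1 := norm_node_div_le_half t h
  rw [← sub_eq_zero.mp h0, norm_one] at h1
  norm_num at h1

lemma exp_logFactor (t : ℕ → ℝ) {i j : ℕ} (h : i ≠ j) :
    Complex.exp (logFactor t j i) = 1 - node t j / node t i := by
  rcases lt_or_gt_of_ne h with h | h
  · have hlead : Complex.exp (leadingLog t j i) = -(node t j / node t i) := by
      rw [leadingLog, if_pos h, Complex.exp_add, ← Complex.ofReal_exp,
        Real.exp_log (div_pos (modulus_pos j) (modulus_pos i)), node_div, Complex.ofReal_add,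
        add_mul, Complex.exp_add, Complex.exp_pi_mul_I]
      ring
    rw [logFactor, Complex.exp_add, hlead, interaction, if_pos h, exp_ratioLog t h]
    have h1 := node_ne_zero t i
    have h2 := node_ne_zero t j
    field_simp
    ring
  · rw [logFactor, leadingLog, if_neg h.not_gt, add_zero, interaction, if_neg h.not_gt, if_pos h,
      exp_ratioLog t h]

lemma logFactor_self (t : ℕ → ℝ) (j : ℕ) : logFactor t j j = 0 := by
  simp [logFactor, leadingLog, interaction]

lemma hasSum_leadingLog (t : ℕ → ℝ) (j : ℕ) :
    HasSum (leadingLog t j) (∑ i ∈ Finset.range j, leadingLog t j i) :=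
  hasSum_sum_of_ne_finset_zero fun i hi => if_neg (by simpa using hi)

lemma summable_logFactor (t : ℕ → ℝ) (j : ℕ) : Summable (logFactor t j) :=
  (summable_interaction t j).add (hasSum_leadingLog t j).summable

lemma im_tsum_logFactor {t : ℕ → ℝ} (ht : phaseMap t = t) {j : ℕ} (hj : j ≠ 0) :
    (∑' i, logFactor t j i).im = 0 := by
  have hlead : (∑ i ∈ Finset.range j, leadingLog t j i).im =
      j * phase t j - ∑ i ∈ Finset.range j, phase t i + j * Real.pi := by
    rw [Complex.im_sum, Finset.sum_congr rfl (g := fun i => phase t j - phase t i + Real.pi)]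
    · simp [Finset.sum_add_distrib, Finset.sum_sub_distrib]
    · intro i hi
      simp [leadingLog, Finset.mem_range.mp hi]
  have hfix := congrFun ht j
  have hj0 : (j : ℝ) ≠ 0 := by exact_mod_cast hj
  have hj1 : (j : ℝ) + 1 ≠ 0 := by positivity
  rw [phaseMap, div_eq_iff (mul_ne_zero hj0 hj1)] at hfix
  have h := ((summable_interaction t j).hasSum.add (hasSum_leadingLog t j)).tsum_eq
  simp only [logFactor]
  rw [h, Complex.add_im, hlead]
  nth_rewrite 1 [phase]
  linarith

lemma tsum_logFactor_zero (t : ℕ → ℝ) :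
    ∑' i, logFactor t 0 i = ∑' i, interaction t 0 i := by
  simp [logFactor, leadingLog]

lemma le_re_sum_logFactor (t : ℕ → ℝ) {j N : ℕ} (h : j < N) :
    j * Real.log 2 - 3 ≤ (∑ i ∈ Finset.range N, logFactor t j i).re := by
  have hlead : j * Real.log 2 ≤ (∑ i ∈ Finset.range N, leadingLog t j i).re := by
    rw [← Finset.sum_subset (Finset.range_subset_range.mpr h.le)
      (f := leadingLog t j)
      (fun i _ hi => if_neg (by simpa using hi)), Complex.re_sum]
    calc j * Real.log 2 = ∑ _i ∈ Finset.range j, Real.log 2 := by simp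
      _ ≤ _ := Finset.sum_le_sum fun i hi => ?_
    have hi := Finset.mem_range.mp hi
    have h1 := norm_node_div_le_half t hi
    rw [norm_div, norm_node, norm_node, div_le_iff₀ (modulus_pos j)] at h1
    have h2 : Real.log 2 ≤ Real.log (modulus j / modulus i) := by
      refine Real.log_le_log two_pos ((le_div_iff₀ (modulus_pos i)).mpr (by linarith))
    simpa only [leadingLog, if_pos hi, Complex.add_re, Complex.ofReal_re, Complex.mul_re,
      Complex.I_re, mul_zero, Complex.ofReal_im, Complex.I_im, mul_one, sub_self, add_zero] using h2
  have hint : ‖∑ i ∈ Finset.range N, interaction t j i‖ ≤ 3 := by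
    refine (norm_sum_le_of_le _ fun i _ => norm_interaction_le t j i).trans ?_
    have hs := hasSum_geometric_bound (2 * (1 / 64) ^ j) (r := 1 / 64) (by norm_num) (by norm_num)
    refine (hs.summable.sum_le_tsum _ fun i _ => by positivity).trans ?_
    rw [hs.tsum_eq]
    have : (1 / 64 : ℝ) ^ j ≤ 1 := pow_le_one₀ (by norm_num) (by norm_num)
    norm_num at this ⊢
    linarith
  have := (abs_le.mp ((Complex.abs_re_le_norm _).trans hint)).1
  simp only [logFactor]
  rw [Finset.sum_add_distrib, Complex.add_re]
  linarith

lemma norm_exp_neg_sum_logFactor_le (t : ℕ → ℝ) {j N : ℕ} (h : j < N) :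
    ‖Complex.exp (-∑ i ∈ Finset.range N, logFactor t j i)‖ ≤ Real.exp 3 * (1 / 2) ^ j := by
  have h2 : Real.exp 3 * (1 / 2) ^ j = Real.exp (3 - j * Real.log 2) := by
    rw [Real.exp_sub, Real.exp_nat_mul, Real.exp_log two_pos, one_div, inv_pow, div_eq_mul_inv]
  rw [Complex.norm_exp, h2, Real.exp_le_exp, Complex.neg_re]
  linarith [le_re_sum_logFactor t h]

lemma exp_sum_logFactor (t : ℕ → ℝ) {j N : ℕ} (h : j < N) :
    Complex.exp (∑ i ∈ Finset.range N, logFactor t j i) =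
      ∏ i ∈ (Finset.range N).erase j, (1 - node t j / node t i) := by
  rw [Complex.exp_sum, ← Finset.mul_prod_erase _ _ (Finset.mem_range.mpr h), logFactor_self,
    Complex.exp_zero, one_mul]
  exact Finset.prod_congr rfl fun i hi => exp_logFactor t (Finset.ne_of_mem_erase hi)

lemma node_injective (t : ℕ → ℝ) : Function.Injective (node t) := by
  have h {i j : ℕ} (hij : i < j) : node t i ≠ node t j := fun h0 => by
    have h1 := norm_node_div_le_half t hij
    rw [h0, div_self (node_ne_zero t j), norm_one] at h1
    norm_num at h1
  intro i j hij
  by_contra hne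
  rcases lt_or_gt_of_ne hne with hlt | hlt
  · exact h hlt hij
  · exact h hlt hij.symm

/-- Partial fractions of the reciprocal of a finite product over the poles. -/
lemma prod_mul_sum_partial_fractions (t : ℕ → ℝ) {N : ℕ} (hN : 0 < N) {w : ℂ}
    (hw : ∀ k, w ≠ node t k) :
    (∏ i ∈ Finset.range N, (1 - w / node t i)) *
      ∑ j ∈ Finset.range N, Complex.exp (-∑ i ∈ Finset.range N, logFactor t j i) *
        (node t j / (w - node t j)) = -1 := by
  have hsum := congrArg (Polynomial.eval w) (Lagrange.sum_basis (s := Finset.range N)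
    (node_injective t).injOn (Finset.nonempty_range_iff.mpr hN.ne'))
  rw [Polynomial.eval_finsetSum, Polynomial.eval_one] at hsum
  refine Eq.trans ?_ (congrArg Neg.neg hsum)
  rw [Finset.mul_sum, ← Finset.sum_neg_distrib]
  refine Finset.sum_congr rfl fun j hj => ?_
  have hbasis : Polynomial.eval w (Lagrange.basis (Finset.range N) (node t) j) =
      (∏ i ∈ (Finset.range N).erase j, (1 - w / node t i)) /
        ∏ i ∈ (Finset.range N).erase j, (1 - node t j / node t i) := by
    rw [Lagrange.basis, Polynomial.eval_prod, ← Finset.prod_div_distrib]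
    refine Finset.prod_congr rfl fun i hi => ?_
    have h1 := node_ne_zero t i
    have h2 : node t j - node t i ≠ 0 :=
      sub_ne_zero.mpr ((node_injective t).ne (Finset.ne_of_mem_erase hi).symm)
    have h3 : node t i - node t j ≠ 0 := sub_ne_zero.mpr (sub_ne_zero.mp h2).symm
    rw [Lagrange.basisDivisor, one_sub_div h1, one_sub_div h1, div_div_div_cancel_right₀ h1]
    simp only [Polynomial.eval_mul, Polynomial.eval_C, Polynomial.eval_sub, Polynomial.eval_X]
    field_simp
    ring
  rw [hbasis, ← exp_sum_logFactor t (Finset.mem_range.mp hj), ← Finset.mul_prod_erase _ _ hj,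
    Complex.exp_neg]
  have h1 := node_ne_zero t j
  have h2 : w - node t j ≠ 0 := sub_ne_zero.mpr (hw j)
  have h3 := Complex.exp_ne_zero (∑ i ∈ Finset.range N, logFactor t j i)
  field_simp
  ring

lemma tendsto_norm_node (t : ℕ → ℝ) : Tendsto (fun k => ‖node t k‖) atTop atTop := by
  refine tendsto_atTop_mono (fun k => ?_) (tendsto_pow_atTop_atTop_of_one_lt (one_lt_two (α := ℝ)))
  rw [norm_node]
  exact two_pow_le_modulus k

lemma exists_norm_node_div_sub_le (t : ℕ → ℝ) (w : ℂ) :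
    ∃ C, ∀ k, ‖node t k / (w - node t k)‖ ≤ C := by
  have hinv : Tendsto (fun k => (node t k)⁻¹) atTop (nhds 0) :=
    tendsto_inv₀_cobounded.comp (tendsto_norm_atTop_iff_cobounded.mp (tendsto_norm_node t))
  have h : Tendsto (fun k => (w * (node t k)⁻¹ - 1)⁻¹) atTop (nhds (w * 0 - 1)⁻¹) :=
    ((hinv.const_mul w).sub_const 1).inv₀ (by norm_num)
  obtain ⟨C, hC⟩ := (Metric.isBounded_range_of_tendsto _ h).exists_norm_le
  refine ⟨C, fun k => ?_⟩
  have hk := hC _ ⟨k, rfl⟩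
  dsimp only at hk
  rwa [← div_eq_mul_inv, div_sub_one (node_ne_zero t k), inv_div] at hk

/-- The coefficient of `node t j / (w - node t j)` in the counterexample. -/
noncomputable def weight (t : ℕ → ℝ) (j : ℕ) : ℂ := Complex.exp (-∑' i, logFactor t j i)

lemma tendsto_exp_neg_sum_logFactor (t : ℕ → ℝ) (j : ℕ) :
    Tendsto (fun N => Complex.exp (-∑ i ∈ Finset.range N, logFactor t j i)) atTop
      (nhds (weight t j)) :=
  (Complex.continuous_exp.tendsto _).comp (summable_logFactor t j).hasSum.tendsto_sum_nat.neg

lemma norm_weight_le (t : ℕ → ℝ) (j : ℕ) : ‖weight t j‖ ≤ Real.exp 3 * (1 / 2) ^ j := by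
  refine le_of_tendsto (tendsto_exp_neg_sum_logFactor t j).norm ?_
  filter_upwards [eventually_gt_atTop j] with N hN
  exact norm_exp_neg_sum_logFactor_le t hN

lemma summable_exp_three_mul : Summable (fun j : ℕ => Real.exp 3 * (1 / 2 : ℝ) ^ j) :=
  (hasSum_geometric_bound _ (by norm_num) (by norm_num)).summable

lemma summable_weight_mul (t : ℕ → ℝ) (w : ℂ) :
    Summable (fun j => weight t j * (node t j / (w - node t j))) := by
  obtain ⟨C, hC⟩ := exists_norm_node_div_sub_le t w
  refine (summable_exp_three_mul.mul_right C).of_norm_bounded fun j => ?_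
  rw [norm_mul]
  exact mul_le_mul (norm_weight_le t j) (hC j) (norm_nonneg _) (by positivity)

lemma tendsto_sum_partial_fractions (t : ℕ → ℝ) (w : ℂ) :
    Tendsto (fun N => ∑ j ∈ Finset.range N,
        Complex.exp (-∑ i ∈ Finset.range N, logFactor t j i) * (node t j / (w - node t j)))
      atTop (nhds (∑' j, weight t j * (node t j / (w - node t j)))) := by
  obtain ⟨C, hC⟩ := exists_norm_node_div_sub_le t w
  have hC0 : 0 ≤ C := (norm_nonneg _).trans (hC 0)
  let f (N j : ℕ) : ℂ := if j < N then
    Complex.exp (-∑ i ∈ Finset.range N, logFactor t j i) * (node t j / (w - node t j)) else 0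
  have hf (N : ℕ) : ∑' j, f N j = ∑ j ∈ Finset.range N,
      Complex.exp (-∑ i ∈ Finset.range N, logFactor t j i) * (node t j / (w - node t j)) := by
    rw [tsum_eq_sum (s := Finset.range N) fun j hj => if_neg (by simpa using hj)]
    exact Finset.sum_congr rfl fun j hj => if_pos (Finset.mem_range.mp hj)
  simp only [← hf]
  refine tendsto_tsum_of_dominated_convergence (summable_exp_three_mul.mul_right C) (fun j => ?_)
    (Eventually.of_forall fun N j => ?_)
  · refine ((tendsto_exp_neg_sum_logFactor t j).mul_const _).congr' ?_
    filter_upwards [eventually_gt_atTop j] with N hN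
    exact (if_pos hN).symm
  · by_cases h : j < N
    · simp only [f, if_pos h]
      rw [norm_mul]
      exact mul_le_mul (norm_exp_neg_sum_logFactor_le t h) (hC j) (norm_nonneg _) (by positivity)
    · simp only [f, if_neg h, norm_zero]
      positivity

lemma norm_prod_one_sub_le (t : ℕ → ℝ) (w : ℂ) (N : ℕ) :
    ‖∏ i ∈ Finset.range N, (1 - w / node t i)‖ ≤ Real.exp (‖w‖ * 2) := by
  have hterm (i : ℕ) : ‖1 - w / node t i‖ ≤ Real.exp (‖w‖ * (1 / 2) ^ i) := by
    calc ‖1 - w / node t i‖ ≤ ‖(1 : ℂ)‖ + ‖w / node t i‖ := norm_sub_le _ _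
      _ ≤ ‖w‖ * (1 / 2) ^ i + 1 := by
        rw [norm_one, norm_div, norm_node, add_comm, div_eq_mul_inv, one_div, inv_pow]
        gcongr
        exact two_pow_le_modulus i
      _ ≤ _ := Real.add_one_le_exp _
  rw [norm_prod]
  refine (Finset.prod_le_prod (fun i _ => norm_nonneg _) fun i _ => hterm i).trans ?_
  rw [← Real.exp_sum, Real.exp_le_exp]
  have hs := hasSum_geometric_bound ‖w‖ (r := 1 / 2) (by norm_num) (by norm_num)
  refine (hs.summable.sum_le_tsum _ fun i _ => by positivity).trans ?_
  rw [hs.tsum_eq]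
  norm_num

lemma tsum_weight_mul_ne_zero (t : ℕ → ℝ) {w : ℂ} (hw : ∀ k, w ≠ node t k) :
    ∑' j, weight t j * (node t j / (w - node t j)) ≠ 0 := by
  intro h0
  have hlim := ((tendsto_sum_partial_fractions t w).norm).const_mul (Real.exp (‖w‖ * 2))
  rw [h0, norm_zero, mul_zero] at hlim
  refine absurd (ge_of_tendsto hlim (b := 1) ?_) (by norm_num)
  filter_upwards [eventually_gt_atTop 0] with N hN
  have h := congrArg norm (prod_mul_sum_partial_fractions t hN hw)
  rw [norm_mul, norm_neg, norm_one] at h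
  rw [← h]
  gcongr
  exact norm_prod_one_sub_le t w N

lemma tsum_weight (t : ℕ → ℝ) : ∑' j, weight t j = 1 := by
  have hw (k : ℕ) : (0 : ℂ) ≠ node t k := (node_ne_zero t k).symm
  have hlim := tendsto_nhds_unique_of_eventuallyEq (tendsto_sum_partial_fractions t 0)
    (tendsto_const_nhds (x := (-1 : ℂ))) (by
      filter_upwards [eventually_gt_atTop 0] with N hN
      simpa using prod_mul_sum_partial_fractions t hN hw)
  have hterm (j : ℕ) : weight t j * (node t j / (0 - node t j)) = -weight t j := by
    rw [zero_sub, div_neg, div_self (node_ne_zero t j), mul_neg, mul_one]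
  simp only [hterm, tsum_neg] at hlim
  exact neg_injective hlim

lemma weight_of_im_eq_zero {t : ℕ → ℝ} {j : ℕ} (h : (∑' i, logFactor t j i).im = 0) :
    weight t j = (Real.exp (-(∑' i, logFactor t j i).re) : ℝ) := by
  rw [weight, Complex.ofReal_exp]
  congr 1
  apply Complex.ext <;> simp [h]

lemma im_tsum_logFactor_zero {t : ℕ → ℝ} (ht : phaseMap t = t) :
    (∑' i, logFactor t 0 i).im = 0 := by
  have him : (weight t 0).im = 0 := by
    have h := congrArg Complex.im (tsum_weight t)
    rw [Complex.im_tsum (summable_exp_three_mul.of_norm_bounded (norm_weight_le t)),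
      tsum_eq_single 0 fun j hj => by
        rw [weight_of_im_eq_zero (im_tsum_logFactor ht hj), Complex.ofReal_im]] at h
    simpa using h
  have hbound : |(∑' i, logFactor t 0 i).im| ≤ 3 := by
    rw [tsum_logFactor_zero]
    exact (Complex.abs_im_le_norm _).trans (norm_tsum_interaction_le t 0)
  rw [abs_le] at hbound
  rw [weight, Complex.exp_im, mul_eq_zero, Complex.neg_im, Real.sin_neg, neg_eq_zero] at him
  have hsin := him.resolve_left (Real.exp_pos _).ne'
  have hpi := Real.pi_gt_three
  exact (Real.sin_eq_zero_iff_of_lt_of_lt (by linarith) (by linarith)).mp hsin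

lemma exists_weight_eq_ofReal {t : ℕ → ℝ} (ht : phaseMap t = t) (j : ℕ) :
    ∃ d : ℝ, 0 < d ∧ weight t j = d := by
  refine ⟨_, Real.exp_pos _, weight_of_im_eq_zero ?_⟩
  rcases eq_or_ne j 0 with rfl | hj
  · exact im_tsum_logFactor_zero ht
  · exact im_tsum_logFactor ht hj

/-- Counterexample to Borcea's Conjecture 6: there are z_k → ∞ and coefficients
a_k with a_k·conj(z_k) real and positive and ∑ |a_k/z_k| < ∞, such that
f(z) = ∑_k a_k/(z - z_k) (which converges off the poles) has no zeros in ℂ. -/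
theorem stmt_9 :
    ∃ (z a : ℕ → ℂ),
      Tendsto (fun k => ‖z k‖) atTop atTop ∧
      (∀ k, (a k * (starRingEnd ℂ) (z k)).im = 0 ∧ 0 < (a k * (starRingEnd ℂ) (z k)).re) ∧
      Summable (fun k => ‖a k / z k‖) ∧
      ∀ w : ℂ, (∀ k, w ≠ z k) →
        Summable (fun k => a k / (w - z k)) ∧
        (∑' k, a k / (w - z k)) ≠ 0 := by
  obtain ⟨t, ht⟩ := exists_phaseMap_fixedPoint
  have hterm (w : ℂ) (k : ℕ) : weight t k * node t k / (w - node t k) =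
      weight t k * (node t k / (w - node t k)) := mul_div_assoc _ _ _
  refine ⟨node t, fun k => weight t k * node t k, tendsto_norm_node t, fun k => ?_, ?_,
    fun w hw => ?_⟩
  · obtain ⟨d, hd, hweight⟩ := exists_weight_eq_ofReal ht k
    dsimp only
    rw [hweight, mul_assoc, Complex.mul_conj, ← Complex.ofReal_mul]
    exact ⟨Complex.ofReal_im _, mul_pos hd (Complex.normSq_pos.mpr (node_ne_zero t k))⟩
  · simp only [mul_div_cancel_right₀ _ (node_ne_zero t _)]
    exact (summable_exp_three_mul.of_nonneg_of_le (fun _ => norm_nonneg _) (norm_weight_le t))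
  · simp only [hterm]
    exact ⟨summable_weight_mul t w, tsum_weight_mul_ne_zero t hw⟩
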